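/- arXiv:2105.01555 — 3 statements merged into one kernel-verified Lean document; each statement's English description precedes it below -/
import Mathlib

section
/- Let d ∈ ℕ, d ≥ 2, and let T₁ be the (d²+1)×(d²+1) matrix of the SIC certificate. Define vectors in ℝ^{d²+1} (coordinates indexed 0,…,d²): v₀ = (1, 1/d, …, 1/d); for 1 ≤ k ≤ d²−1, v_k has its first k coordinates equal to 0, coordinate k equal to 1, and all remaining coordinates equal to −1/(d²−k); and v_{d²} = (−1, 1/d, …, 1/d). Then the vectors v₀, v₁, …, v_{d²} are pairwise orthogonal and are eigenvectors of T₁ with T₁v₀ = 2·v₀, T₁v_k = (1/(d+1))·v_k for 1 ≤ k ≤ d²−1, and T₁v_{d²} = 0. -/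
open Matrix

/-- The SIC certificate `T₁`: the `(d²+1)×(d²+1)` real symmetric matrix with rows and columns
indexed by `{0,1,…,d²}`, with `(T₁)_{0,0} = 1`, `(T₁)_{0,x} = (T₁)_{x,0} = 1/d`,
`(T₁)_{x,x} = 1/d`, and `(T₁)_{x,y} = 1/(d(d+1))` for distinct `x,y ∈ {1,…,d²}`. -/
noncomputable def sicCert (d : ℕ) : Matrix (Fin (d ^ 2 + 1)) (Fin (d ^ 2 + 1)) ℝ :=
  Matrix.of fun x y =>
    if x = y then (if (x : ℕ) = 0 then 1 else 1 / d)
    else if (x : ℕ) = 0 ∨ (y : ℕ) = 0 then 1 / d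
    else 1 / (d * ((d : ℝ) + 1))

/-- The vectors `v₀, …, v_{d²}` of Appendix A: `v₀ = (1, 1/d, …, 1/d)`; for `1 ≤ k ≤ d²−1`,
`v_k` has its first `k` coordinates `0`, coordinate `k` equal to `1`, and the remaining
coordinates equal to `−1/(d²−k)`; and `v_{d²} = (−1, 1/d, …, 1/d)`. -/
noncomputable def sicVec (d k : ℕ) : Fin (d ^ 2 + 1) → ℝ :=
  fun j =>
    if k = 0 then (if (j : ℕ) = 0 then 1 else 1 / d)
    else if k = d ^ 2 then (if (j : ℕ) = 0 then -1 else 1 / d)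
    else if (j : ℕ) < k then 0
    else if (j : ℕ) = k then 1
    else -1 / ((d ^ 2 : ℝ) - k)

lemma sic_sum_aux (c : ℝ) (k n : ℕ) (hk : 1 ≤ k) (hn : k ≤ n) :
    ∑ i ∈ Finset.range n, (if i + 1 < k then (0:ℝ) else if i + 1 = k then 1 else c)
      = 1 + ((n:ℝ) - k) * c := by
  induction n, hn using Nat.le_induction with
  | base =>
    obtain ⟨m, rfl⟩ : ∃ m, k = m + 1 := ⟨k - 1, by omega⟩
    rw [Finset.sum_range_succ, Finset.sum_eq_zero]
    · simp
    · intro i hi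
      have := Finset.mem_range.1 hi
      rw [if_pos (by omega)]
  | succ n hn ih =>
    rw [Finset.sum_range_succ, ih, if_neg (by omega), if_neg (by omega)]
    push_cast
    ring

lemma sic_sum_mid (d k : ℕ) (hk : 1 ≤ k) (hk2 : k < d ^ 2) :
    ∑ i : Fin (d ^ 2), sicVec d k i.succ = 0 := by
  have h := sic_sum_aux (-1 / ((d ^ 2 : ℝ) - k)) k (d ^ 2) hk hk2.le
  rw [← Fin.sum_univ_eq_sum_range
    (fun i => (if i + 1 < k then (0:ℝ) else if i + 1 = k then 1 else -1 / ((d ^ 2 : ℝ) - k)))] at h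
  have e : ∀ i : Fin (d ^ 2), sicVec d k i.succ = (if (i : ℕ) + 1 < k then (0:ℝ) else
      if (i : ℕ) + 1 = k then 1 else -1 / ((d ^ 2 : ℝ) - k)) := by
    intro i
    have h1 : k ≠ 0 := by omega
    have h2 : k ≠ d ^ 2 := by omega
    simp only [sicVec, h1, h2, if_false, Fin.val_succ]
  rw [Finset.sum_congr rfl (fun i _ => e i), h]
  have : ((d:ℝ) ^ 2 - k) ≠ 0 := by
    have : (k:ℝ) < (d:ℝ) ^ 2 := by exact_mod_cast hk2
    linarith
  push_cast
  field_simp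
  ring

lemma sic_mid_zero (d k : ℕ) (hk : 1 ≤ k) (hk2 : k < d ^ 2) : sicVec d k 0 = 0 := by
  have h1 : k ≠ 0 := by omega
  have h2 : k ≠ d ^ 2 := by omega
  have h3 : 0 < k := by omega
  simp [sicVec, h1, h2, h3]

lemma sic_mul (d : ℕ) (v : Fin (d ^ 2 + 1) → ℝ) (S : ℝ)
    (hS : ∑ i : Fin (d ^ 2), v i.succ = S) :
    (sicCert d *ᵥ v) 0 = v 0 + 1 / d * S ∧
    ∀ x : Fin (d ^ 2), (sicCert d *ᵥ v) x.succ = 1 / d * v 0 + 1 / (d * ((d : ℝ) + 1)) * S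
      + (1 / d - 1 / (d * ((d : ℝ) + 1))) * v x.succ := by
  subst hS
  constructor
  · simp only [Matrix.mulVec, dotProduct, Fin.sum_univ_succ, Finset.mul_sum]
    refine congrArg₂ (· + ·) ?_ ?_
    · simp [sicCert]
    · refine Finset.sum_congr rfl fun i _ => ?_
      have : (0 : Fin (d ^ 2 + 1)) ≠ i.succ := (Fin.succ_ne_zero i).symm
      simp [sicCert, this]
  · intro x
    simp only [Matrix.mulVec, dotProduct, Fin.sum_univ_succ, Finset.mul_sum]
    rw [add_assoc]
    refine congrArg₂ (· + ·) ?_ ?_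
    · simp [sicCert]
    · have : (1 / (d:ℝ) - 1 / (d * ((d : ℝ) + 1))) * v x.succ = ∑ i : Fin (d ^ 2),
          if x = i then (1 / (d:ℝ) - 1 / (d * ((d : ℝ) + 1))) * v i.succ else 0 := by simp
      rw [this, ← Finset.sum_add_distrib]
      refine Finset.sum_congr rfl fun i _ => ?_
      by_cases h : x = i
      · subst h
        simp [sicCert]
        ring
      · simp [sicCert, h]

lemma sic_orth (d : ℕ) (hd : 2 ≤ d) (k l : ℕ) (hl : l ≤ d ^ 2) (h : k < l) :
    dotProduct (sicVec d k) (sicVec d l) = 0 := by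
  have hd0 : (d:ℝ) ≠ 0 := by positivity
  have hdd : d ^ 2 ≠ 0 := by positivity
  have e0 : ∀ i : Fin (d ^ 2), sicVec d 0 i.succ = 1 / d := by intro i; simp [sicVec]
  have e1 : ∀ i : Fin (d ^ 2), sicVec d (d ^ 2) i.succ = 1 / d := by
    intro i; simp [sicVec]
  rcases Nat.eq_zero_or_pos k with rfl | hk
  · rcases hl.eq_or_lt with rfl | hl
    · simp only [dotProduct, Fin.sum_univ_succ, e0, e1]
      have : d ≠ 0 := by omega
      simp [sicVec, this]
      field_simp
      ring
    · simp only [dotProduct, Fin.sum_univ_succ, e0, ← Finset.mul_sum]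
      rw [sic_sum_mid d l h hl, sic_mid_zero d l h hl]
      simp
  · rcases hl.eq_or_lt with rfl | hl
    · simp only [dotProduct, Fin.sum_univ_succ, e1, ← Finset.sum_mul]
      rw [sic_sum_mid d k hk h, sic_mid_zero d k hk h]
      simp
    · have e : ∀ i, sicVec d k i * sicVec d l i = -1 / ((d ^ 2 : ℝ) - k) * sicVec d l i := by
        intro i
        have h1 : k ≠ 0 := by omega
        have h2 : k ≠ d ^ 2 := by omega
        have h3 : l ≠ 0 := by omega
        have h4 : l ≠ d ^ 2 := by omega
        simp only [sicVec, h1, h2, h3, h4, if_false]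
        by_cases h5 : (i : ℕ) < l
        · simp [h5]
        · have h6 : ¬ (i : ℕ) < k := by omega
          have h7 : (i : ℕ) ≠ k := by omega
          simp only [h6, h7, if_false]
      simp only [dotProduct, e, ← Finset.mul_sum]
      rw [Fin.sum_univ_succ, sic_sum_mid d l (by omega) hl, sic_mid_zero d l (by omega) hl]
      simp

/-- the vectors `v₀, v₁, …, v_{d²}` are pairwise orthogonal eigenvectors of
the SIC certificate `T₁`, with `T₁v₀ = 2v₀`, `T₁v_k = (1/(d+1))v_k` for `1 ≤ k ≤ d²−1`, and
`T₁v_{d²} = 0`. -/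
theorem stmt11 (d : ℕ) (hd : 2 ≤ d) :
    (∀ k l : ℕ, k ≤ d ^ 2 → l ≤ d ^ 2 → k ≠ l →
      dotProduct (sicVec d k) (sicVec d l) = 0) ∧
    sicCert d *ᵥ sicVec d 0 = (2 : ℝ) • sicVec d 0 ∧
    (∀ k : ℕ, 1 ≤ k → k ≤ d ^ 2 - 1 →
      sicCert d *ᵥ sicVec d k = (1 / ((d : ℝ) + 1)) • sicVec d k) ∧
    sicCert d *ᵥ sicVec d (d ^ 2) = 0 := by
  have hd0 : (d:ℝ) ≠ 0 := by positivity
  have hdn : d ≠ 0 := by omega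
  have hd1 : (d:ℝ) + 1 ≠ 0 := by positivity
  have e0 : ∀ i : Fin (d ^ 2), sicVec d 0 i.succ = 1 / d := by intro i; simp [sicVec]
  have e1 : ∀ i : Fin (d ^ 2), sicVec d (d ^ 2) i.succ = 1 / d := by
    intro i; simp [sicVec]
  have z0 : sicVec d 0 0 = 1 := by simp [sicVec]
  have z1 : sicVec d (d ^ 2) 0 = -1 := by simp [sicVec, hdn]
  refine ⟨?_, ?_, ?_, ?_⟩
  · intro k l hk hl hkl
    rcases lt_or_gt_of_ne hkl with h | h
    · exact sic_orth d hd k l hl h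
    · rw [dotProduct_comm]
      exact sic_orth d hd l k hk h
  · obtain ⟨a, b⟩ := sic_mul d (sicVec d 0) d (by simp [e0]; field_simp)
    funext x
    refine Fin.cases ?_ (fun x => ?_) x
    · rw [a, Pi.smul_apply, z0, smul_eq_mul]
      field_simp
      try ring
    · rw [b, Pi.smul_apply, z0, e0, smul_eq_mul]
      field_simp
      try ring
  · intro k hk hk2
    have hk3 : k < d ^ 2 := by
      have : 0 < d ^ 2 := by positivity
      omega
    obtain ⟨a, b⟩ := sic_mul d (sicVec d k) 0 (sic_sum_mid d k hk hk3)
    funext x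
    refine Fin.cases ?_ (fun x => ?_) x
    · rw [a, Pi.smul_apply, sic_mid_zero d k hk hk3]
      simp
    · rw [b, Pi.smul_apply, sic_mid_zero d k hk hk3, smul_eq_mul]
      field_simp
      try ring
  · obtain ⟨a, b⟩ := sic_mul d (sicVec d (d ^ 2)) d (by simp [e1]; field_simp)
    funext x
    refine Fin.cases ?_ (fun x => ?_) x
    · rw [a, z1, Pi.zero_apply]
      field_simp
      try ring
    · rw [b, z1, e1, Pi.zero_apply]
      field_simp
      try ring
end

section
/- Let n,k ∈ ℕ and let p(a,b|x,y), a,b ∈ [k], x,y ∈ [n], be a synchronous correlation. Then p is a quantum commuting correlation if and only if there exist a unital C*-algebra 𝔄, projection-valued measures {E_{x,a}}_{a=1}^{k} ⊆ 𝔄 for each x ∈ [n] (i.e., each E_{x,a} is a projection and ∑_{a=1}^{k} E_{x,a} = 1), and a tracial state τ on 𝔄 such that p(a,b|x,y) = τ(E_{x,a} E_{y,b}) for all a,b ∈ [k] and x,y ∈ [n]. -/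
open scoped ComplexOrder

/-- A correlation with `n` questions and `k` answers: `∑_{a,b} p(a,b|x,y) = 1` for all
`x, y`.  Here `p a b x y` denotes `p(a,b|x,y)`. -/
def IsCorrelation {n k : ℕ} (p : Fin k → Fin k → Fin n → Fin n → ℂ) : Prop :=
  ∀ x y, ∑ a, ∑ b, p a b x y = 1

/-- A correlation is synchronous if `p(a,b|x,x) = 0` whenever `a ≠ b`. -/
def IsSynchronous {n k : ℕ} (p : Fin k → Fin k → Fin n → Fin n → ℂ) : Prop :=
  ∀ a b x, a ≠ b → p a b x x = 0

/-- A unital C*-algebra (bundled). -/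
structure CStarAlg where
  carrier : Type
  [inst : CStarAlgebra carrier]

attribute [instance] CStarAlg.inst

/-- `p` is a quantum commuting correlation: there are a unital C*-algebra `A`,
projection-valued measures `{E_{x,a}}ₐ` and `{F_{y,b}}_b` in `A` with every `E_{x,a}`
commuting with every `F_{y,b}`, and a state `φ` on `A` with `p(a,b|x,y) = φ(E_{x,a}F_{y,b})`. -/
def IsQCCorrelation {n k : ℕ} (p : Fin k → Fin k → Fin n → Fin n → ℂ) : Prop :=
  ∃ (A : CStarAlg) (E F : Fin n → Fin k → A.carrier) (φ : A.carrier →ₗ[ℂ] ℂ),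
    (∀ x a, IsSelfAdjoint (E x a) ∧ IsIdempotentElem (E x a)) ∧
    (∀ x, ∑ a, E x a = 1) ∧
    (∀ y b, IsSelfAdjoint (F y b) ∧ IsIdempotentElem (F y b)) ∧
    (∀ y, ∑ b, F y b = 1) ∧
    (∀ x a y b, Commute (E x a) (F y b)) ∧
    φ 1 = 1 ∧ (∀ a, 0 ≤ φ (star a * a)) ∧
    (∀ a b x y, p a b x y = φ (E x a * F y b))

open scoped InnerProductSpace

namespace SyncQC

section
variable {A : Type} [CStarAlgebra A] [PartialOrder A] [StarOrderedRing A]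

/-- A positive functional given on squares, as a positive linear map. -/
noncomputable def toPos (φ : A →ₗ[ℂ] ℂ) (h : ∀ a, 0 ≤ φ (star a * a)) : A →ₚ[ℂ] ℂ :=
  PositiveLinearMap.mk₀ φ (by
    intro x hx
    obtain ⟨y, rfl⟩ := CStarAlgebra.nonneg_iff_eq_star_mul_self.mp hx
    exact h y)

lemma toPos_apply (φ : A →ₗ[ℂ] ℂ) (h : ∀ a, 0 ≤ φ (star a * a)) (a : A) :
    toPos φ h a = φ a := rfl

lemma cs (f : A →ₚ[ℂ] ℂ) (d z : A) (hd : f (star d * d) = 0) : f (z * d) = 0 := by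
  have h0 : ‖f.toPreGNS d‖ = 0 := by
    rw [PositiveLinearMap.preGNS_norm_def]; simp [hd]
  have h1 := norm_inner_le_norm (𝕜 := ℂ) (f.toPreGNS (star z)) (f.toPreGNS d)
  rw [h0, mul_zero, PositiveLinearMap.preGNS_inner_def] at h1
  simpa using h1

/-- Right multiplication by a projection, on the pre-GNS space of a trace. -/
noncomputable def rightMul (f : A →ₚ[ℂ] ℂ) (ht : ∀ a b, f (a * b) = f (b * a)) (e : A)
    (he : IsSelfAdjoint e ∧ IsIdempotentElem e) : f.PreGNS →L[ℂ] f.PreGNS :=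
  (f.toPreGNS.toLinearMap ∘ₗ LinearMap.mulRight ℂ e ∘ₗ f.ofPreGNS.toLinearMap).mkContinuous 1
    fun x ↦ by
      rw [one_mul, PositiveLinearMap.preGNS_norm_def, PositiveLinearMap.preGNS_norm_def]
      apply Real.sqrt_le_sqrt
      set y := f.ofPreGNS x with hy
      have h1 : 0 ≤ f (star (y * (1 - e)) * (y * (1 - e))) :=
        f.map_nonneg (star_mul_self_nonneg _)
      have hi : e * e = e := he.2
      have hs : star e = e := he.1
      have hi' : (1 - e) * (1 - e) = 1 - e := by
        simp [mul_sub, sub_mul, hi]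
      have h2 : f (star (y * (1 - e)) * (y * (1 - e))) = f (star y * y) - f (star y * y * e) := by
        rw [star_mul, star_sub, star_one, hs, mul_assoc, ht]
        simp only [mul_assoc]
        rw [hi', mul_sub, mul_sub, mul_one, map_sub]
      have h3 : f (star (y * e) * (y * e)) = f (star y * y * e) := by
        rw [star_mul, hs, mul_assoc, ht]
        simp only [mul_assoc]
        rw [hi]
      have h4 : (f (star (y * e) * (y * e))).re ≤ (f (star y * y)).re := by
        rw [h2] at h1
        have := (Complex.le_def.mp h1).1
        rw [h3]
        simp at this
        linarith
      exact h4

lemma rightMul_apply (f : A →ₚ[ℂ] ℂ) (ht : ∀ a b, f (a * b) = f (b * a)) (e : A)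
    (he : IsSelfAdjoint e ∧ IsIdempotentElem e) (x : f.PreGNS) :
    rightMul f ht e he x = f.toPreGNS (f.ofPreGNS x * e) := rfl

end

end SyncQC

open SyncQC UniformSpace Completion in
theorem SyncQC.backward (n k : ℕ) (p : Fin k → Fin k → Fin n → Fin n → ℂ)
    (A : CStarAlg) (E : Fin n → Fin k → A.carrier) (τ : A.carrier →ₗ[ℂ] ℂ)
    (hE : ∀ x a, IsSelfAdjoint (E x a) ∧ IsIdempotentElem (E x a))
    (hE1 : ∀ x, ∑ a, E x a = 1)
    (h1 : τ 1 = 1) (hpos : ∀ a, 0 ≤ τ (star a * a)) (ht : ∀ a b, τ (a * b) = τ (b * a))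
    (hp : ∀ a b x y, p a b x y = τ (E x a * E y b)) : IsQCCorrelation p := by
  letI := CStarAlgebra.spectralOrder A.carrier
  haveI := CStarAlgebra.spectralOrderedRing A.carrier
  obtain ⟨f, hf⟩ : ∃ f : A.carrier →ₚ[ℂ] ℂ, ∀ a, f a = τ a := ⟨toPos τ hpos, fun _ => rfl⟩
  have htf : ∀ a b, f (a * b) = f (b * a) := fun a b => by rw [hf, hf, ht]
  let Om : f.GNS := (f.toPreGNS 1 : f.PreGNS)
  let φ : (f.GNS →L[ℂ] f.GNS) →ₗ[ℂ] ℂ :=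
    { toFun := fun T => ⟪Om, T Om⟫_ℂ
      map_add' := fun S T => by simp [inner_add_right]
      map_smul' := fun c T => by simp [inner_smul_right] }
  have hφ : ∀ T, φ T = ⟪Om, T Om⟫_ℂ := fun _ => rfl
  refine ⟨⟨f.GNS →L[ℂ] f.GNS⟩, fun x a => f.gnsStarAlgHom (E x a),
    fun y b => (rightMul f htf (E y b) (hE y b)).completion, φ, ?_, ?_, ?_, ?_, ?_, ?_, ?_, ?_⟩
  · intro x a
    exact ⟨(hE x a).1.map _, (hE x a).2.map _⟩
  · intro x
    rw [← map_sum, hE1, map_one]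
  · intro y b
    refine ⟨?_, ?_⟩
    · refine ContinuousLinearMap.isSelfAdjoint_iff_isSymmetric.mpr ?_
      intro u v
      induction u, v using induction_on₂ with
      | hp => apply isClosed_eq <;> (simp only [ContinuousLinearMap.coe_coe]; fun_prop)
      | ih u v =>
        simp only [ContinuousLinearMap.coe_coe, ContinuousLinearMap.completion_apply_coe, Completion.inner_coe,
          PositiveLinearMap.preGNS_inner_def, rightMul_apply,
          PositiveLinearMap.ofPreGNS_toPreGNS, star_mul, (hE y b).1.star_eq, hf]
        rw [mul_assoc, ht, mul_assoc]
    · ext u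
      induction u using induction_on with
      | hp => apply isClosed_eq <;> fun_prop
      | ih u =>
        rw [ContinuousLinearMap.mul_apply]
        simp only [ContinuousLinearMap.completion_apply_coe, rightMul_apply,
          PositiveLinearMap.ofPreGNS_toPreGNS, mul_assoc]
        rw [(hE y b).2.eq]
  · intro y
    ext u
    induction u using induction_on with
    | hp => apply isClosed_eq <;> fun_prop
    | ih u =>
      rw [ContinuousLinearMap.sum_apply]
      simp only [ContinuousLinearMap.completion_apply_coe, rightMul_apply]
      have := map_sum (Completion.toComplL (𝕜 := ℂ) (E := f.PreGNS))
        (fun b => f.toPreGNS (f.ofPreGNS u * E y b)) Finset.univ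
      simp only [Completion.coe_toComplL] at this
      rw [← this, ← map_sum, ← Finset.mul_sum, hE1]
      simp
  · intro x a y b
    change _ * _ = _ * _
    ext u
    induction u using induction_on with
    | hp => apply isClosed_eq <;> fun_prop
    | ih u =>
      rw [ContinuousLinearMap.mul_apply, ContinuousLinearMap.mul_apply]
      simp [rightMul_apply, mul_assoc]
  · rw [hφ]
    change ⟪Om, Om⟫_ℂ = 1
    rw [Completion.inner_coe, PositiveLinearMap.preGNS_inner_def]
    simp [hf, h1]
  · intro T
    rw [hφ, ContinuousLinearMap.star_eq_adjoint, ContinuousLinearMap.mul_apply,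
      ContinuousLinearMap.adjoint_inner_right]
    rw [inner_self_eq_norm_sq_to_K]
    have h : (0 : ℂ) ≤ ((‖T Om‖ ^ 2 : ℝ) : ℂ) := Complex.zero_le_real.mpr (sq_nonneg ‖T Om‖)
    rw [Complex.ofReal_pow] at h
    exact h
  · intro a b x y
    rw [hφ, ContinuousLinearMap.mul_apply, hp]
    simp [Om, PositiveLinearMap.preGNS_inner_def, hf, rightMul_apply]

open SyncQC in
theorem SyncQC.forward (n k : ℕ) (p : Fin k → Fin k → Fin n → Fin n → ℂ)
    (hsync : IsSynchronous p)
    (A : CStarAlg) (E F : Fin n → Fin k → A.carrier) (φ : A.carrier →ₗ[ℂ] ℂ)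
    (hE : ∀ x a, IsSelfAdjoint (E x a) ∧ IsIdempotentElem (E x a))
    (hE1 : ∀ x, ∑ a, E x a = 1)
    (hF : ∀ x a, IsSelfAdjoint (F x a) ∧ IsIdempotentElem (F x a))
    (hF1 : ∀ x, ∑ a, F x a = 1)
    (hc : ∀ x a y b, Commute (E x a) (F y b))
    (h1 : φ 1 = 1) (hpos : ∀ a, 0 ≤ φ (star a * a))
    (hp : ∀ a b x y, p a b x y = φ (E x a * F y b)) :
      ∃ (A : CStarAlg) (E : Fin n → Fin k → A.carrier) (τ : A.carrier →ₗ[ℂ] ℂ),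
        (∀ x a, IsSelfAdjoint (E x a) ∧ IsIdempotentElem (E x a)) ∧
        (∀ x, ∑ a, E x a = 1) ∧
        τ 1 = 1 ∧ (∀ a, 0 ≤ τ (star a * a)) ∧ (∀ a b, τ (a * b) = τ (b * a)) ∧
        (∀ a b x y, p a b x y = τ (E x a * E y b)) := by
  letI := CStarAlgebra.spectralOrder A.carrier
  haveI := CStarAlgebra.spectralOrderedRing A.carrier
  let f := toPos φ hpos
  have hf : ∀ a, f a = φ a := fun _ => rfl
  have hcont : Continuous φ := map_continuous f
  have hstar : ∀ a, φ (star a) = star (φ a) := fun a => map_star f a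
  have hEF : ∀ x a, φ (E x a) = φ (E x a * F x a) := by
    intro x a
    conv_lhs => rw [← mul_one (E x a), ← hF1 x, Finset.mul_sum, map_sum]
    refine Finset.sum_eq_single a (fun b _ hb => ?_) (by simp)
    rw [← hp]; exact hsync _ _ _ hb.symm
  have hFE : ∀ x a, φ (F x a) = φ (E x a * F x a) := by
    intro x a
    conv_lhs => rw [← one_mul (F x a), ← hE1 x, Finset.sum_mul, map_sum]
    refine Finset.sum_eq_single a (fun b _ hb => ?_) (by simp)
    rw [← hp]; exact hsync _ _ _ hb
  have hd : ∀ x a, φ (star (E x a - F x a) * (E x a - F x a)) = 0 := by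
    intro x a
    rw [star_sub, (hE x a).1.star_eq, (hF x a).1.star_eq, sub_mul, mul_sub, mul_sub,
      (hE x a).2.eq, (hF x a).2.eq, ← (hc x a x a).eq]
    simp only [map_sub]
    rw [hEF, hFE]; ring
  have hr : ∀ x a z, φ (z * E x a) = φ (z * F x a) := by
    intro x a z
    have := cs f _ z (hd x a)
    rw [hf, mul_sub, map_sub, sub_eq_zero] at this
    exact this
  have hl : ∀ x a z, φ (E x a * z) = φ (F x a * z) := by
    intro x a z
    have := hr x a (star z)
    have h2 := congrArg star this
    rw [← hstar, ← hstar] at h2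
    simpa [(hE x a).1.star_eq, (hF x a).1.star_eq] using h2
  let s : Set A.carrier := Set.range (fun q : Fin n × Fin k => E q.1 q.2)
  let B : StarSubalgebra ℂ A.carrier := (StarAlgebra.adjoin ℂ s).topologicalClosure
  have hBc : IsClosed (B : Set A.carrier) := StarSubalgebra.isClosed_topologicalClosure _
  have hsB : ∀ x a, E x a ∈ B := fun x a =>
    StarSubalgebra.le_topologicalClosure _ (StarAlgebra.subset_adjoin ℂ s ⟨(x, a), rfl⟩)
  have hcomm : ∀ z ∈ B, ∀ y b, F y b * z = z * F y b := by
    intro z hz y b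
    have hcl : IsClosed {z : A.carrier | F y b * z = z * F y b} :=
      isClosed_eq (by fun_prop) (by fun_prop)
    refine closure_minimal ?_ hcl hz
    intro w hw
    change F y b * w = w * F y b
    induction hw using StarAlgebra.adjoin_induction with
    | mem u hu => obtain ⟨q, rfl⟩ := hu; exact (hc _ _ _ _).eq.symm
    | algebraMap r => exact (Algebra.commutes r _).symm
    | add u v _ _ hu hv => rw [mul_add, add_mul, hu, hv]
    | mul u v _ _ hu hv => rw [← mul_assoc, hu, mul_assoc, hv, mul_assoc]
    | star u _ hu =>
      have := congrArg star hu
      simpa [(hF y b).1.star_eq] using this.symm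
  have htr : ∀ w ∈ B, ∀ z ∈ B, φ (z * w) = φ (w * z) := by
    intro w hw
    have hcl : IsClosed {w : A.carrier | ∀ z ∈ B, φ (z * w) = φ (w * z)} := by
      simp only [Set.setOf_forall]
      refine isClosed_iInter fun z => isClosed_iInter fun _ => isClosed_eq (by fun_prop) (by fun_prop)
    refine closure_minimal ?_ hcl hw
    intro w hw
    change ∀ z ∈ B, φ (z * w) = φ (w * z)
    have hle : ∀ u ∈ StarAlgebra.adjoin ℂ s, u ∈ B :=
      fun u hu => StarSubalgebra.le_topologicalClosure _ hu
    induction hw using StarAlgebra.adjoin_induction with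
    | mem u hu =>
      obtain ⟨q, rfl⟩ := hu
      intro z hz
      change φ (z * E q.1 q.2) = φ (E q.1 q.2 * z)
      rw [hr, hl, hcomm z hz]
    | algebraMap r => intro z _; rw [Algebra.commutes r z]
    | add u v _ _ hu hv => intro z hz; rw [mul_add, add_mul, map_add, map_add, hu z hz, hv z hz]
    | mul u v hu' hv' hu hv =>
      intro z hz
      rw [← mul_assoc, hv _ (mul_mem hz (hle u hu')), ← mul_assoc,
        hu _ (mul_mem (hle v hv') hz), ← mul_assoc]
    | star u _ hu =>
      intro z hz
      have := congrArg star (hu (star z) (star_mem hz))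
      rw [← hstar, ← hstar] at this
      simpa using this.symm
  letI : CStarAlgebra B := StarSubalgebra.cstarAlgebra B (h_closed := hBc)
  refine ⟨⟨B⟩, fun x a => ⟨E x a, hsB x a⟩, φ ∘ₗ B.subtype.toLinearMap, ?_, ?_, ?_, ?_, ?_, ?_⟩
  · intro x a
    exact ⟨Subtype.ext (hE x a).1, Subtype.ext (hE x a).2⟩
  · intro x
    apply Subtype.ext
    have := map_sum B.subtype (fun a => (⟨E x a, hsB x a⟩ : B)) Finset.univ
    exact this.trans (hE1 x)
  · exact h1
  · intro a; exact hpos a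
  · intro a b; exact htr _ b.2 _ a.2
  · intro a b x y
    rw [hp]
    exact (hr y b (E x a)).symm

/-- synchronous quantum commuting correlations, after Corollary 5.6 of
Paulsen et al.: a synchronous correlation `p` is quantum commuting iff there are a unital
C*-algebra `A`, projection-valued measures `{E_{x,a}}ₐ ⊆ A`, and a tracial state `τ` on `A`
with `p(a,b|x,y) = τ(E_{x,a}E_{y,b})`. -/
theorem stmt17 (n k : ℕ) (p : Fin k → Fin k → Fin n → Fin n → ℂ)
    (hcorr : IsCorrelation p) (hsync : IsSynchronous p) :
    IsQCCorrelation p ↔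
      ∃ (A : CStarAlg) (E : Fin n → Fin k → A.carrier) (τ : A.carrier →ₗ[ℂ] ℂ),
        (∀ x a, IsSelfAdjoint (E x a) ∧ IsIdempotentElem (E x a)) ∧
        (∀ x, ∑ a, E x a = 1) ∧
        τ 1 = 1 ∧ (∀ a, 0 ≤ τ (star a * a)) ∧ (∀ a b, τ (a * b) = τ (b * a)) ∧
        (∀ a b x y, p a b x y = τ (E x a * E y b)) := by
  constructor
  · rintro ⟨A, E, F, φ, hE, hE1, hF, hF1, hc, h1, hpos, hp⟩
    exact SyncQC.forward n k p hsync A E F φ hE hE1 hF hF1 hc h1 hpos hp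
  · rintro ⟨A, E, τ, hE, hE1, h1, hpos, ht, hp⟩
    exact SyncQC.backward n k p A E τ hE hE1 h1 hpos ht hp
end

section
/- Let n,k ∈ ℕ and let p(a,b|x,y), a,b ∈ [k], x,y ∈ [n], be a synchronous correlation. Then p is a quantum correlation if and only if there exist a finite-dimensional unital C*-algebra 𝔄, projection-valued measures {E_{x,a}}_{a=1}^{k} ⊆ 𝔄 for each x ∈ [n] (i.e., each E_{x,a} is a projection and ∑_{a=1}^{k} E_{x,a} = 1), and a tracial state τ on 𝔄 such that p(a,b|x,y) = τ(E_{x,a} E_{y,b}) for all a,b ∈ [k] and x,y ∈ [n]. -/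
open Matrix
open scoped ComplexOrder Kronecker

/-- A finite-dimensional unital C*-algebra (bundled). -/
structure FDCStarAlg where
  carrier : Type
  [inst : CStarAlgebra carrier]
  [fd : FiniteDimensional ℂ carrier]

attribute [instance] FDCStarAlg.inst FDCStarAlg.fd

/-- `p` is a quantum correlation: there are a finite-dimensional Hilbert space `H ≅ ℂ^m`,
projection-valued measures `{E_{x,a}}ₐ` and `{F_{y,b}}_b` on `H`, and a unit vector
`φ ∈ H ⊗ H ≅ ℂ^{m×m}` with `p(a,b|x,y) = ⟨φ| E_{x,a} ⊗ F_{y,b} |φ⟩`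
(`⊗ₖ` is the Kronecker product, realizing the tensor product of operators). -/
def IsQuantumCorrelation {n k : ℕ} (p : Fin k → Fin k → Fin n → Fin n → ℂ) : Prop :=
  ∃ (m : ℕ) (E F : Fin n → Fin k → Matrix (Fin m) (Fin m) ℂ) (φ : Fin m × Fin m → ℂ),
    (∀ x a, (E x a).IsHermitian ∧ E x a * E x a = E x a) ∧
    (∀ x, ∑ a, E x a = 1) ∧
    (∀ y b, (F y b).IsHermitian ∧ F y b * F y b = F y b) ∧
    (∀ y, ∑ b, F y b = 1) ∧
    dotProduct (star φ) φ = 1 ∧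
    (∀ a b x y, p a b x y = dotProduct (star φ) ((E x a ⊗ₖ F y b) *ᵥ φ))


lemma aux_herm {B : Type*} [CStarAlgebra B] (t : B →ₗ[ℂ] ℂ) (tp : ∀ a, 0 ≤ t (star a * a))
    (x : B) : t (star x) = star (t x) := by
  have h0 := tp 1
  have h1 := tp (1 + x)
  have h2 := tp (1 + Complex.I • x)
  have h3 := tp x
  have h4 := tp (Complex.I • x)
  have e1 : t (star (1 + x) * (1 + x)) = t (star (1:B) * 1) + t x + t (star x) + t (star x * x) := by
    simp only [star_add, star_one, add_mul, mul_add, one_mul, mul_one, map_add]; ring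
  have e2 : t (star (1 + Complex.I • x) * (1 + Complex.I • x)) =
      t (star (1:B) * 1) + Complex.I * t x - Complex.I * t (star x) + t (star x * x) := by
    simp only [star_add, star_one, add_mul, mul_add, one_mul, mul_one, map_add, star_smul,
      smul_mul_smul_comm, map_smul, smul_eq_mul, RCLike.star_def, Complex.conj_I]
    have : -Complex.I * Complex.I = 1 := by simp
    rw [this]; ring
  rw [e1] at h1
  rw [e2] at h2
  rw [Complex.nonneg_iff] at h0 h1 h2 h3
  have i0 := h0.2
  have i1 := h1.2
  have i2 := h2.2
  have i3 := h3.2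
  simp at i0 i1 i2 i3
  apply Complex.ext
  · simp; linarith
  · simp; linarith

lemma aux_density {B : Type*} [CStarAlgebra B] [FiniteDimensional ℂ B]
    (t s : B →ₗ[ℂ] ℂ)
    (tp : ∀ a, 0 ≤ t (star a * a)) (tt : ∀ a b, t (a * b) = t (b * a))
    (tf : ∀ a, t (star a * a) = 0 → a = 0)
    (sp : ∀ a, 0 ≤ s (star a * a)) (st : ∀ a b, s (a * b) = s (b * a)) :
    ∃ y : B, star y = y ∧ (∀ x, y * x = x * y) ∧ ∀ x, s x = t (y * y * x) := by
  let _ := CStarAlgebra.spectralOrder B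
  have := CStarAlgebra.spectralOrderedRing B
  have nd : ∀ r, (∀ x, t (r * x) = 0) → r = 0 := fun r h => tf r (by rw [tt]; exact h _)
  let T : B →ₗ[ℂ] Module.Dual ℂ B := (LinearMap.mul ℂ B).compr₂ t
  have hT : Function.Injective T := by
    rw [injective_iff_map_eq_zero]
    intro r hr
    exact nd r fun x => by simpa [T] using LinearMap.congr_fun hr x
  have hS : Function.Surjective T :=
    (LinearMap.injective_iff_surjective_of_finrank_eq_finrank
      (Subspace.dual_finrank_eq).symm).1 hT
  obtain ⟨r, hr⟩ := hS s
  have hr' : ∀ x, t (r * x) = s x := fun x => by simpa [T] using LinearMap.congr_fun hr x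
  have hc : ∀ x, r * x = x * r := by
    intro x
    rw [← sub_eq_zero]
    apply nd
    intro y
    rw [sub_mul, map_sub, mul_assoc, hr', mul_assoc, tt x, mul_assoc, hr', st, sub_self]
  have hsa : star r = r := by
    rw [← sub_eq_zero]
    apply nd
    intro y
    have : star r * y = star (star y * r) := by simp
    rw [sub_mul, map_sub, hr', this, aux_herm t tp, tt, hr', aux_herm s sp, star_star, sub_self]
  have hsa' : IsSelfAdjoint r := hsa
  have hN0 : 0 ≤ r⁻ := CFC.negPart_nonneg r
  have hN : r⁻ = 0 := by
    have hNs : star r⁻ = r⁻ := (IsSelfAdjoint.of_nonneg hN0)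
    have h1 : r * r⁻ = -(r⁻ * r⁻) := by
      calc r * r⁻ = (r⁺ - r⁻) * r⁻ := by rw [CFC.posPart_sub_negPart r hsa']
        _ = _ := by rw [sub_mul, CFC.posPart_mul_negPart, zero_sub]
    have q := CFC.sqrt_mul_sqrt_self r⁻ hN0
    have hq : star (CFC.sqrt r⁻) = CFC.sqrt r⁻ := IsSelfAdjoint.of_nonneg (CFC.sqrt_nonneg _)
    have h2 := sp r⁻
    rw [← hr', hNs, ← mul_assoc, h1] at h2
    have h3 := tp (CFC.sqrt r⁻ * r⁻)
    have e : star (CFC.sqrt r⁻ * r⁻) * (CFC.sqrt r⁻ * r⁻) = r⁻ * r⁻ * r⁻ := by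
      rw [star_mul, hq, hNs]
      calc _ = r⁻ * (CFC.sqrt r⁻ * CFC.sqrt r⁻) * r⁻ := by simp only [mul_assoc]
        _ = _ := by rw [q]
    rw [neg_mul, map_neg, ← e] at h2
    have h4 := tf _ (le_antisymm (neg_nonneg.1 h2) h3)
    apply tf
    rw [hNs]
    nth_rewrite 1 [← q]
    rw [mul_assoc, h4, mul_zero, map_zero]
  have hr0 : 0 ≤ r := by
    rw [← CFC.posPart_sub_negPart r hsa', hN, sub_zero]; exact CFC.posPart_nonneg r
  refine ⟨CFC.sqrt r, IsSelfAdjoint.of_nonneg (CFC.sqrt_nonneg _), fun x => ?_, fun x => ?_⟩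
  · exact (Commute.cfcₙ_nnreal (hc x) _ : Commute (CFC.sqrt r) x)
  · rw [CFC.sqrt_mul_sqrt_self r hr0, hr']

lemma aux_rep {A : Type} [CStarAlgebra A] [FiniteDimensional ℂ A] (t : A →ₗ[ℂ] ℂ)
    (tp : ∀ a, 0 ≤ t (star a * a)) :
    ∃ (m : ℕ) (π : A →⋆ₐ[ℂ] Matrix (Fin m) (Fin m) ℂ), ∀ a, π a = 0 → t a = 0 := by
  let _ := CStarAlgebra.spectralOrder A
  have := CStarAlgebra.spectralOrderedRing A
  let f : A →ₚ[ℂ] ℂ := PositiveLinearMap.mk₀ t (fun a ha => by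
    obtain ⟨b, rfl⟩ := CStarAlgebra.nonneg_iff_eq_star_mul_self.1 ha
    exact tp b)
  have hf : ∀ a, f a = t a := fun a => rfl
  have _ : FiniteDimensional ℂ f.PreGNS := f.toPreGNS.finiteDimensional
  have _ : FiniteDimensional ℂ f.GNS := by
    let c : f.PreGNS →ₗ[ℂ] f.GNS := (UniformSpace.Completion.toComplL (𝕜 := ℂ) (E := f.PreGNS)).toLinearMap
    have hd : (LinearMap.range c).topologicalClosure = ⊤ := by
      rw [← Submodule.dense_iff_topologicalClosure_eq_top]
      have := UniformSpace.Completion.denseRange_coe (α := f.PreGNS)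
      exact this
    have hcl : IsClosed (LinearMap.range c : Set f.GNS) := Submodule.closed_of_finiteDimensional _
    rw [IsClosed.submodule_topologicalClosure_eq hcl] at hd
    exact Module.Finite.of_surjective c (LinearMap.range_eq_top.1 hd)
  let b := stdOrthonormalBasis ℂ f.GNS
  let g : (f.GNS →L[ℂ] f.GNS) →⋆ₐ[ℂ] Matrix _ _ ℂ :=
    { toFun := fun T => LinearMap.toMatrixOrthonormal b T.toLinearMap
      map_one' := by
        exact map_one (LinearMap.toMatrixOrthonormal b)
      map_mul' := fun x y => by
        exact map_mul (LinearMap.toMatrixOrthonormal b) _ _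
      map_zero' := by
        exact map_zero (LinearMap.toMatrixOrthonormal b)
      map_add' := fun x y => by
        exact map_add (LinearMap.toMatrixOrthonormal b) _ _
      commutes' := fun r => by
        exact AlgHomClass.commutes (LinearMap.toMatrixOrthonormal b) r
      map_star' := fun x => by
        rw [← map_star]
        congr 1 }
  have hg : ∀ T, g T = 0 → T = 0 := by
    intro T hT
    have : LinearMap.toMatrixOrthonormal b T.toLinearMap = LinearMap.toMatrixOrthonormal b 0 := by
      rw [map_zero]; exact hT
    have := (LinearMap.toMatrixOrthonormal b).injective this
    ext v
    exact LinearMap.congr_fun this v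
  refine ⟨_, g.comp f.gnsStarAlgHom, fun a ha => ?_⟩
  have h1 : f.gnsStarAlgHom a = 0 := hg _ ha
  have h2 : f.gnsNonUnitalStarAlgHom a (f.toPreGNS 1 : f.PreGNS) = 0 := by
    change f.gnsStarAlgHom a _ = 0
    rw [h1]; rfl
  rw [PositiveLinearMap.gnsNonUnitalStarAlgHom_apply_coe] at h2
  have h3 : inner ℂ ((f.toPreGNS 1 : f.PreGNS) : f.GNS) (f.leftMulMapPreGNS a (f.toPreGNS 1) : f.GNS) = 0 := by
    rw [h2, inner_zero_right]
  rw [UniformSpace.Completion.inner_coe, PositiveLinearMap.preGNS_inner_def] at h3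
  simpa [hf] using h3

lemma aux_trace_pos {m : ℕ} (X : Matrix (Fin m) (Fin m) ℂ) : 0 ≤ (Xᴴ * X).trace :=
  (Matrix.posSemidef_conjTranspose_mul_self X).trace_nonneg

open scoped Matrix.Norms.L2Operator in
lemma aux_closed {m : ℕ} (S : StarSubalgebra ℂ (Matrix (Fin m) (Fin m) ℂ)) :
    IsClosed (S : Set (Matrix (Fin m) (Fin m) ℂ)) :=
  Submodule.closed_of_finiteDimensional (Subalgebra.toSubmodule S.toSubalgebra)

open scoped Matrix.Norms.L2Operator in
lemma aux_matrix {A : Type} [CStarAlgebra A] [FiniteDimensional ℂ A] (t : A →ₗ[ℂ] ℂ)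
    (tp : ∀ a, 0 ≤ t (star a * a)) (tt : ∀ a b, t (a * b) = t (b * a)) :
    ∃ (m : ℕ) (π : A →⋆ₐ[ℂ] Matrix (Fin m) (Fin m) ℂ) (y : Matrix (Fin m) (Fin m) ℂ),
      yᴴ = y ∧ (∀ a, y * π a = π a * y) ∧ ∀ a, t a = (y * y * π a).trace := by
  obtain ⟨m, π, hπ⟩ := aux_rep t tp
  let S := π.range
  have _ : IsClosed (S : Set (Matrix (Fin m) (Fin m) ℂ)) := aux_closed S
  have _ : FiniteDimensional ℂ S :=
    inferInstanceAs (FiniteDimensional ℂ (Subalgebra.toSubmodule S.toSubalgebra))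
  let P : A →ₗ[ℂ] S := π.rangeRestrict.toAlgHom.toLinearMap
  have hP : ∀ a, ((P a : S) : Matrix (Fin m) (Fin m) ℂ) = π a := fun a => rfl
  have hPs : Function.Surjective P := by
    rintro ⟨_, a, rfl⟩
    exact ⟨a, rfl⟩
  obtain ⟨g, hg⟩ := P.exists_rightInverse_of_surjective (LinearMap.range_eq_top.2 hPs)
  let s : S →ₗ[ℂ] ℂ := t ∘ₗ g
  have hs : ∀ a, s (P a) = t a := by
    intro a
    have : π (g (P a) - a) = 0 := by
      rw [map_sub, ← hP, ← hP, sub_eq_zero]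
      exact congrArg Subtype.val (LinearMap.congr_fun hg (P a))
    have := hπ _ this
    rw [map_sub, sub_eq_zero] at this
    exact this
  have hPm : ∀ a b, P a * P b = P (a * b) := fun a b => (map_mul π.rangeRestrict a b).symm
  have hPst : ∀ a, star (P a) = P (star a) := fun a => (map_star π.rangeRestrict a).symm
  let T : S →ₗ[ℂ] ℂ := Matrix.traceLinearMap (Fin m) ℂ ℂ ∘ₗ S.toSubalgebra.val.toLinearMap
  have hT : ∀ x : S, T x = (x : Matrix (Fin m) (Fin m) ℂ).trace := fun x => rfl
  obtain ⟨y, h1, h2, h3⟩ := aux_density T s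
    (fun a => by rw [hT]; exact aux_trace_pos _)
    (fun a b => by rw [hT, hT]; exact Matrix.trace_mul_comm _ _)
    (fun a h => by
      rw [hT] at h
      exact Subtype.ext (Matrix.trace_conjTranspose_mul_self_eq_zero_iff.1 h))
    (fun a => by
      obtain ⟨a, rfl⟩ := hPs a
      rw [hPst, hPm, hs]; exact tp a)
    (fun a b => by
      obtain ⟨a, rfl⟩ := hPs a
      obtain ⟨b, rfl⟩ := hPs b
      rw [hPm, hPm, hs, hs]; exact tt a b)
  refine ⟨m, π, y, congrArg Subtype.val h1, fun a => congrArg Subtype.val (h2 (P a)), fun a => ?_⟩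
  rw [← hs, h3]; rfl

lemma aux_vec {m : ℕ} (X E F : Matrix (Fin m) (Fin m) ℂ) :
    dotProduct (star (vec X)) ((E ⊗ₖ F) *ᵥ vec X) = (Xᴴ * (F * X * Eᵀ)).trace := by
  rw [kronecker_mulVec_vec, star_vec_dotProduct_vec]

lemma aux_vec' {m : ℕ} (φ : Fin m × Fin m → ℂ) : ∃ X : Matrix (Fin m) (Fin m) ℂ, φ = vec X :=
  ⟨Matrix.of fun i j => φ (j, i), rfl⟩

open scoped Matrix.Norms.L2Operator in
theorem aux_fwd (n k : ℕ) (p : Fin k → Fin k → Fin n → Fin n → ℂ)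
    (hsync : IsSynchronous p) (h : IsQuantumCorrelation p) :
      ∃ (A : FDCStarAlg) (E : Fin n → Fin k → A.carrier) (τ : A.carrier →ₗ[ℂ] ℂ),
        (∀ x a, IsSelfAdjoint (E x a) ∧ IsIdempotentElem (E x a)) ∧
        (∀ x, ∑ a, E x a = 1) ∧
        τ 1 = 1 ∧ (∀ a, 0 ≤ τ (star a * a)) ∧ (∀ a b, τ (a * b) = τ (b * a)) ∧
        (∀ a b x y, p a b x y = τ (E x a * E y b)) := by
  obtain ⟨m, E, F, φ, hE, hE1, hF, hF1, hφ, hp⟩ := h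
  obtain ⟨X, rfl⟩ := aux_vec' φ
  simp only [aux_vec] at hp
  have hz : ∀ x a b, a ≠ b → F x b * X * (E x a)ᵀ = 0 := by
    intro x a b hab
    have h := hsync a b x hab
    rw [hp] at h
    rw [← Matrix.trace_conjTranspose_mul_self_eq_zero_iff, ← h]
    have e1 : ((E x a)ᵀ)ᴴ = (E x a)ᵀ := (hE x a).1.transpose.eq
    have e2 : (E x a)ᵀ * (E x a)ᵀ = (E x a)ᵀ := by
      rw [← transpose_mul, (hE x a).2]
    rw [conjTranspose_mul, conjTranspose_mul, e1, (hF x b).1.eq, Matrix.mul_assoc, trace_mul_comm]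
    congr 1
    calc _ = Xᴴ * ((F x b * F x b) * X * ((E x a)ᵀ * (E x a)ᵀ)) := by
          simp only [Matrix.mul_assoc]
      _ = _ := by rw [e2, (hF x b).2]
  have hi : ∀ x a, F x a * X = X * (E x a)ᵀ := by
    intro x a
    have s1 : F x a * X = F x a * X * (E x a)ᵀ := by
      calc F x a * X = F x a * X * (∑ b, E x b)ᵀ := by simp [hE1]
        _ = ∑ b, F x a * X * (E x b)ᵀ := by rw [transpose_sum, Finset.mul_sum]
        _ = _ := Finset.sum_eq_single a (fun b _ hb => hz x b a hb) (by simp)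
    have s2 : X * (E x a)ᵀ = F x a * X * (E x a)ᵀ := by
      calc X * (E x a)ᵀ = (∑ b, F x b) * X * (E x a)ᵀ := by simp [hF1]
        _ = ∑ b, F x b * X * (E x a)ᵀ := by rw [Finset.sum_mul, Finset.sum_mul]
        _ = _ := Finset.sum_eq_single a (fun b _ hb => hz x a b hb.symm) (by simp)
    rw [s1, ← s2]
  have hi' : ∀ x a, Xᴴ * F x a = (E x a)ᵀ * Xᴴ := by
    intro x a
    have := congrArg conjTranspose (hi x a)
    rwa [conjTranspose_mul, conjTranspose_mul, (hF x a).1.eq,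
      (hE x a).1.transpose.eq] at this
  let ρ := X * Xᴴ
  have hρ : star ρ = ρ := by simp [ρ, star_eq_conjTranspose]
  let S := StarSubalgebra.centralizer ℂ {ρ}
  have hS : ∀ z, z ∈ S ↔ ρ * z = z * ρ := by
    intro z; simp [S, StarSubalgebra.mem_centralizer_iff, hρ]
  have _ : IsClosed (S : Set (Matrix (Fin m) (Fin m) ℂ)) := aux_closed S
  have _ : FiniteDimensional ℂ S :=
    inferInstanceAs (FiniteDimensional ℂ (Subalgebra.toSubmodule S.toSubalgebra))
  let T : S →ₗ[ℂ] ℂ := Matrix.traceLinearMap (Fin m) ℂ ℂ ∘ₗ (LinearMap.mulLeft ℂ ρ) ∘ₗ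
    S.toSubalgebra.val.toLinearMap
  have hT : ∀ x : S, T x = (ρ * (x : Matrix (Fin m) (Fin m) ℂ)).trace := fun x => rfl
  have hFS : ∀ x a, F x a ∈ S := by
    intro x a
    rw [hS]
    simp only [ρ]
    rw [Matrix.mul_assoc, hi', ← Matrix.mul_assoc, ← hi, Matrix.mul_assoc]
  have hTt : ∀ a b, T (a * b) = T (b * a) := by
    intro a b
    rw [hT, hT]
    have := (hS _).1 a.2
    change (ρ * ((a : Matrix (Fin m) (Fin m) ℂ) * (b : Matrix (Fin m) (Fin m) ℂ))).trace =
      (ρ * ((b : Matrix (Fin m) (Fin m) ℂ) * (a : Matrix (Fin m) (Fin m) ℂ))).trace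
    rw [← Matrix.mul_assoc, this, Matrix.mul_assoc, trace_mul_comm, Matrix.mul_assoc]
  refine ⟨⟨S⟩, fun x a => ⟨F x a, hFS x a⟩, T, ?_, ?_, ?_, ?_, hTt, ?_⟩
  · intro x a
    exact ⟨Subtype.ext (hF x a).1, Subtype.ext (hF x a).2⟩
  · intro x
    apply Subtype.ext
    refine Eq.trans ?_ (hF1 x)
    exact map_sum S.toSubalgebra.val _ _
  · refine (hT 1).trans ?_
    have : ((1 : S) : Matrix (Fin m) (Fin m) ℂ) = 1 := rfl
    rw [this, Matrix.mul_one, trace_mul_comm, ← star_vec_dotProduct_vec, hφ]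
  · intro (a : S)
    refine le_of_le_of_eq (aux_trace_pos ((a : Matrix (Fin m) (Fin m) ℂ) * X)) ?_
    refine Eq.trans ?_ (hT _).symm
    change _ = (X * Xᴴ * ((a : Matrix (Fin m) (Fin m) ℂ)ᴴ * (a : Matrix (Fin m) (Fin m) ℂ))).trace
    rw [conjTranspose_mul, Matrix.mul_assoc X, trace_mul_comm X]
    simp only [Matrix.mul_assoc]
  · intro a b x y
    refine Eq.trans ?_ (hTt _ _)
    refine Eq.trans ?_ (hT _).symm
    change _ = (X * Xᴴ * (F y b * F x a)).trace
    rw [hp, Matrix.mul_assoc (F y b), ← hi, Matrix.mul_assoc X, trace_mul_comm X]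
    simp only [Matrix.mul_assoc]

theorem stmt18 (n k : ℕ) (p : Fin k → Fin k → Fin n → Fin n → ℂ)
    (hcorr : IsCorrelation p) (hsync : IsSynchronous p) :
    IsQuantumCorrelation p ↔
      ∃ (A : FDCStarAlg) (E : Fin n → Fin k → A.carrier) (τ : A.carrier →ₗ[ℂ] ℂ),
        (∀ x a, IsSelfAdjoint (E x a) ∧ IsIdempotentElem (E x a)) ∧
        (∀ x, ∑ a, E x a = 1) ∧
        τ 1 = 1 ∧ (∀ a, 0 ≤ τ (star a * a)) ∧ (∀ a b, τ (a * b) = τ (b * a)) ∧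
        (∀ a b x y, p a b x y = τ (E x a * E y b)) := by
  refine ⟨aux_fwd n k p hsync, ?_⟩
  rintro ⟨A, E, t, hE, hE1, t1, tp, tt, hp⟩
  obtain ⟨m, π, y, hy, hc, hyt⟩ := aux_matrix t tp tt
  have q1 : ∀ x a, (π (E x a)).IsHermitian := by
    intro x a
    have := map_star π (E x a)
    rw [(hE x a).1.star_eq] at this
    exact this.symm
  have q2 : ∀ x a, π (E x a) * π (E x a) = π (E x a) := by
    intro x a
    rw [← map_mul, (hE x a).2.eq]
  have q3 : ∀ x, ∑ a, π (E x a) = 1 := by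
    intro x
    rw [← map_sum, hE1, map_one]
  refine ⟨m, fun x a => (π (E x a))ᵀ, fun x a => π (E x a), vec y, ?_, ?_, ?_, q3, ?_, ?_⟩
  · intro x a
    refine ⟨(q1 x a).transpose, ?_⟩
    rw [← transpose_mul, q2]
  · intro x
    rw [← transpose_sum, q3, transpose_one]
  · exact fun x a => ⟨q1 x a, q2 x a⟩
  · rw [star_vec_dotProduct_vec, hy, ← t1, hyt, map_one, Matrix.mul_one]
  · intro a b x z
    rw [aux_vec, transpose_transpose, hp, tt, hyt, hy, map_mul, ← hc, Matrix.mul_assoc,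
      Matrix.mul_assoc]
end
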